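/- Let φ be an EFD-system in the language 𝓛 of ℓ-groups that is satisfied by some nontrivial abelian ℓ-group. Then there exists a positive integer k such that for every abelian ℓ-group G: G satisfies φ if and only if for every x ∈ G there is exactly one z ∈ G with k • z = x. (Every EFD-sentence with a nontrivial model among abelian ℓ-groups is equivalent over abelian ℓ-groups to δ_k for some k.) -/

import Mathlib

open FirstOrder Language

/-- The binary function symbols of the language of ℓ-groups: `+`, `∨`, `∧`. -/
inductive LGrpBin : Type
  | add : LGrpBin
  | join : LGrpBin
  | meet : LGrpBin

/-- Function symbols of the language of ℓ-groups: a constant `0`, a unary `-`,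
and binary `+`, `∨`, `∧`. -/
def LGrpFunc : ℕ → Type
  | 0 => Unit
  | 1 => Unit
  | 2 => LGrpBin
  | _ => Empty

/-- The first-order language of (abelian) ℓ-groups. -/
def LGrpLang : FirstOrder.Language :=
  ⟨LGrpFunc, fun _ => Empty⟩

/-- The evident `LGrpLang`-structure on any abelian ℓ-group. -/
instance lgrpStructure (G : Type*) [Lattice G] [AddCommGroup G] :
    LGrpLang.Structure G where
  funMap {n} f x :=
    match n, f, x with
    | 0, _, _ => 0
    | 1, _, x => -(x 0)
    | 2, LGrpBin.add, x => x 0 + x 1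
    | 2, LGrpBin.join, x => x 0 ⊔ x 1
    | 2, LGrpBin.meet, x => x 0 ⊓ x 1
    | (_+3), f, _ => f.elim
  RelMap {_} r := r.elim

/-- An EFD-system in a language `L`: data for an EFD-sentence
`∀ x_1 … x_n ∃! z_1 … z_m, ⋀_{i<r} s_i(x̄,z̄) = t_i(x̄,z̄)` with `m, r ≥ 1`. -/
structure EFDSystem (L : FirstOrder.Language) where
  n : ℕ
  m : ℕ
  r : ℕ
  hm : 0 < m
  hr : 0 < r
  lhs : Fin r → L.Term (Fin n ⊕ Fin m)
  rhs : Fin r → L.Term (Fin n ⊕ Fin m)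

/-- A structure `G` satisfies an EFD-system if for every tuple `x` there is exactly one
tuple `z` solving all the equations. -/
def EFDSystem.Satisfies {L : FirstOrder.Language} (φ : EFDSystem L)
    (G : Type*) [L.Structure G] : Prop :=
  ∀ x : Fin φ.n → G, ∃! z : Fin φ.m → G, ∀ i : Fin φ.r,
    Term.realize (Sum.elim x z) (φ.lhs i) = Term.realize (Sum.elim x z) (φ.rhs i)

section Representation

variable {G : Type*} [Lattice G] [AddCommGroup G] [AddLeftMono G]

/-- Solid (convex) `ℓ`-subgroups, given by their underlying subgroups. -/
def AddSubgroup.Solid (C : AddSubgroup G) : Prop :=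
  ∀ ⦃x y : G⦄, |x| ≤ |y| → y ∈ C → x ∈ C

theorem inf_nsmul_eq_zero {a b : G} (h : a ⊓ b = 0) (n : ℕ) : a ⊓ n • b = 0 := by
  have ha : 0 ≤ a := h ▸ inf_le_left
  have hb : 0 ≤ b := h ▸ inf_le_right
  induction n with
  | zero => simpa using ha
  | succ n ih =>
    apply le_antisymm _ (le_inf ha (nsmul_nonneg hb _))
    have h1 : a ⊓ (n + 1) • b ≤ b := by
      calc a ⊓ (n + 1) • b ≤ (b + a) ⊓ (b + n • b) := by
            rw [succ_nsmul' b n]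
            exact inf_le_inf_right _ (le_add_of_nonneg_left hb)
        _ = b := by rw [← add_inf, ih, add_zero]
    calc a ⊓ (n + 1) • b ≤ a ⊓ b := le_inf inf_le_left h1
      _ = 0 := h

/-- The solid subgroup generated by a solid subgroup and one nonnegative element. -/
def AddSubgroup.solidAdjoin (C : AddSubgroup G) (a : G) : AddSubgroup G where
  carrier := {x | ∃ c ∈ C, ∃ n : ℕ, |x| ≤ c + n • a}
  zero_mem' := ⟨0, C.zero_mem, 0, by simp⟩
  add_mem' := by
    rintro x y ⟨c, hc, n, hx⟩ ⟨d, hd, m, hy⟩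
    refine ⟨c + d, C.add_mem hc hd, n + m, (abs_add_le x y).trans ?_⟩
    calc |x| + |y| ≤ (c + n • a) + (d + m • a) := add_le_add hx hy
      _ = c + d + (n + m) • a := by rw [add_nsmul]; abel
  neg_mem' := by
    rintro x ⟨c, hc, n, hx⟩
    exact ⟨c, hc, n, by rwa [abs_neg]⟩

theorem AddSubgroup.exists_maximal_solid {g : G} (hg : g ≠ 0) :
    ∃ C : AddSubgroup G, Maximal (fun D : AddSubgroup G => D.Solid ∧ g ∉ D) C := by
  have hbot : (⊥ : AddSubgroup G).Solid ∧ g ∉ (⊥ : AddSubgroup G) := by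
    refine ⟨fun x y hxy hy => ?_, by simpa using hg⟩
    rw [AddSubgroup.mem_bot] at hy ⊢
    rw [hy, abs_zero] at hxy
    exact le_antisymm ((le_abs_self x).trans hxy)
      (by simpa using (neg_le_abs x).trans hxy)
  have hub : ∀ c ⊆ {D : AddSubgroup G | D.Solid ∧ g ∉ D}, IsChain (· ≤ ·) c → ∀ D ∈ c,
      ∃ ub ∈ {D : AddSubgroup G | D.Solid ∧ g ∉ D}, ∀ z ∈ c, z ≤ ub := by
    intro c hc hchain D hD
    have hmem {x : G} : x ∈ sSup c ↔ ∃ s ∈ c, x ∈ s :=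
      AddSubgroup.mem_sSup_of_directedOn ⟨D, hD⟩ hchain.directedOn
    refine ⟨sSup c, ⟨fun x y hxy hy => ?_, fun hgs => ?_⟩, fun z hz => le_sSup hz⟩
    · obtain ⟨s, hs, hys⟩ := hmem.1 hy
      exact hmem.2 ⟨s, hs, (hc hs).1 hxy hys⟩
    · obtain ⟨s, hs, hgs⟩ := hmem.1 hgs
      exact (hc hs).2 hgs
  obtain ⟨C, -, hC⟩ := zorn_le_nonempty₀ _ hub ⊥ hbot
  exact ⟨C, hC⟩

theorem AddSubgroup.prime_of_maximal_solid {g : G} {C : AddSubgroup G}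
    (hC : Maximal (fun D : AddSubgroup G => D.Solid ∧ g ∉ D) C) {a b : G} (hab : a ⊓ b = 0) :
    a ∈ C ∨ b ∈ C := by
  have key {a : G} (ha : 0 ≤ a) (haC : a ∉ C) : ∃ c ∈ C, ∃ n : ℕ, |g| ≤ c + n • a := by
    by_contra hg
    have hle : C ≤ C.solidAdjoin a := fun x hx =>
      ⟨|x|, hC.prop.1 (by rw [abs_abs]) hx, 0, by simp⟩
    have hsol : (C.solidAdjoin a).Solid := by
      rintro x y hxy ⟨c, hc, n, hy⟩
      exact ⟨c, hc, n, hxy.trans hy⟩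
    refine haC (hC.le_of_ge ⟨hsol, hg⟩ hle ⟨0, C.zero_mem, 1, ?_⟩)
    rw [abs_of_nonneg ha, one_nsmul, zero_add]
  by_contra! h
  have ha : 0 ≤ a := hab ▸ inf_le_left
  have hb : 0 ≤ b := hab ▸ inf_le_right
  obtain ⟨c, hc, n, hn⟩ := key ha h.1
  obtain ⟨d, hd, m, hm⟩ := key hb h.2
  have hz : n • a ⊓ m • b = 0 := by
    apply inf_nsmul_eq_zero
    rw [inf_comm]
    apply inf_nsmul_eq_zero
    rwa [inf_comm]
  have hsolid {x : G} (hx : x ∈ C) : |x| ∈ C := hC.prop.1 (by rw [abs_abs]) hx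
  have hle : |g| ≤ |c| + |d| := by
    calc |g| ≤ (|c| + |d| + n • a) ⊓ (|c| + |d| + m • b) := by
          refine le_inf (hn.trans ?_) (hm.trans ?_)
          · gcongr
            exact (le_abs_self c).trans (le_add_of_nonneg_right (abs_nonneg d))
          · gcongr
            exact (le_abs_self d).trans (le_add_of_nonneg_left (abs_nonneg c))
      _ = |c| + |d| := by rw [← add_inf, hz, add_zero]
  exact hC.prop.2 (hC.prop.1 (hle.trans (le_abs_self _)) (C.add_mem (hsolid hc) (hsolid hd)))

/-- Every nonzero element of an abelian `ℓ`-group survives in a totally ordered quotient. -/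
theorem exists_hom_linearOrder {G : Type} [Lattice G] [AddCommGroup G] [AddLeftMono G]
    {g : G} (hg : g ≠ 0) :
    ∃ (T : Type) (_ : AddCommGroup T) (_ : LinearOrder T) (_ : IsOrderedAddMonoid T)
      (f : G →+ T), (∀ x y, f (x ⊔ y) = f x ⊔ f y) ∧ f g ≠ 0 := by
  classical
  obtain ⟨C, hC⟩ := AddSubgroup.exists_maximal_solid hg
  let π : G →+ G ⧸ C := QuotientAddGroup.mk' C
  have hπ : Function.Surjective π := QuotientAddGroup.mk'_surjective C
  have hker {x : G} : π x = 0 ↔ x ∈ C := QuotientAddGroup.eq_zero_iff x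
  have hprime (x : G) : π x⁺ = 0 ∨ π x⁻ = 0 := by
    rw [hker, hker]
    exact AddSubgroup.prime_of_maximal_solid hC (posPart_inf_negPart_eq_zero x)
  have hsub (x : G) : π x = π x⁺ - π x⁻ := by rw [← map_sub, posPart_sub_negPart]
  let L : LinearOrder (G ⧸ C) :=
    { le a b := ∃ x : G, 0 ≤ x ∧ π x = b - a
      le_refl a := ⟨0, le_rfl, by simp⟩
      le_trans := by
        rintro a b c ⟨x, hx, hxe⟩ ⟨y, hy, hye⟩
        exact ⟨x + y, add_nonneg hx hy, by rw [map_add, hxe, hye]; abel⟩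
      le_antisymm := by
        rintro a b ⟨x, hx, hxe⟩ ⟨y, hy, hye⟩
        have hxy : x + y ∈ C := by rw [← hker, map_add, hxe, hye]; abel
        have hxC : x ∈ C := by
          refine hC.prop.1 ?_ hxy
          rw [abs_of_nonneg hx, abs_of_nonneg (add_nonneg hx hy)]
          exact le_add_of_nonneg_right hy
        rw [← hker, hxe, sub_eq_zero] at hxC
        exact hxC.symm
      le_total := by
        intro a b
        obtain ⟨x, hx⟩ := hπ (b - a)
        rcases hprime x with h | h
        · right
          refine ⟨x⁻, negPart_nonneg x, ?_⟩
          rw [← neg_sub b a, ← hx, hsub x, h]; abel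
        · left
          refine ⟨x⁺, posPart_nonneg x, ?_⟩
          rw [← hx, hsub x, h]; abel
      toDecidableLE := Classical.decRel _ }
  have hmono {x y : G} (h : x ≤ y) : π x ≤ π y := ⟨y - x, sub_nonneg.2 h, map_sub _ _ _⟩
  have hord : IsOrderedAddMonoid (G ⧸ C) :=
    { add_le_add_left := by
        rintro a b ⟨x, hx, hxe⟩ c
        exact ⟨x, hx, by rw [hxe]; abel⟩ }
  refine ⟨G ⧸ C, inferInstance, L, hord, π, fun x y => ?_, fun h => hC.prop.2 (hker.1 h)⟩
  apply le_antisymm _ (sup_le (hmono le_sup_left) (hmono le_sup_right))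
  have hsup : x ⊔ y = y + (x - y)⁺ := sup_eq_add_posPart_sub x y
  rcases hprime (x - y) with h | h
  · rw [hsup, map_add, h, add_zero]
    exact le_sup_right
  · have : π (x ⊔ y) = π x := by
      have h2 := hsub (x - y)
      rw [h, sub_zero, map_sub] at h2
      rw [hsup, map_add, ← h2]; abel
    rw [this]
    exact le_sup_left

end Representation

namespace LGrpTerm

variable {α : Type*}

/-- The constant term `0`. -/
def zero : LGrpLang.Term α := Term.func (l := 0) () ![]

/-- The term `-t`. -/
def neg (t : LGrpLang.Term α) : LGrpLang.Term α := Term.func (l := 1) () ![t]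

/-- The term `t + u`. -/
def add (t u : LGrpLang.Term α) : LGrpLang.Term α := Term.func (l := 2) LGrpBin.add ![t, u]

/-- The term `t ∨ u`. -/
def sup (t u : LGrpLang.Term α) : LGrpLang.Term α := Term.func (l := 2) LGrpBin.join ![t, u]

/-- The term `t ∧ u`. -/
def inf (t u : LGrpLang.Term α) : LGrpLang.Term α := Term.func (l := 2) LGrpBin.meet ![t, u]

section Realize

variable {G : Type*} [Lattice G] [AddCommGroup G] (v : α → G) (t u : LGrpLang.Term α)

@[simp] theorem realize_zero : (zero : LGrpLang.Term α).realize v = 0 := rfl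

@[simp] theorem realize_neg : (neg t).realize v = -t.realize v := rfl

@[simp] theorem realize_add : (add t u).realize v = t.realize v + u.realize v := rfl

@[simp] theorem realize_sup : (sup t u).realize v = t.realize v ⊔ u.realize v := rfl

@[simp] theorem realize_inf : (inf t u).realize v = t.realize v ⊓ u.realize v := rfl

end Realize

theorem induction {P : LGrpLang.Term α → Prop} (hvar : ∀ i, P (Term.var i)) (hzero : P zero)
    (hneg : ∀ t, P t → P (neg t)) (hadd : ∀ t u, P t → P u → P (add t u))
    (hsup : ∀ t u, P t → P u → P (sup t u)) (hinf : ∀ t u, P t → P u → P (inf t u))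
    (t : LGrpLang.Term α) : P t := by
  induction t with
  | var i => exact hvar i
  | @func n f ts ih =>
    match n, f, ts, ih with
    | 0, (), ts, _ =>
      rw [show ts = ![] from Subsingleton.elim _ _]
      exact hzero
    | 1, (), ts, ih =>
      rw [show ts = ![ts 0] by ext i; fin_cases i; rfl]
      exact hneg _ (ih 0)
    | 2, LGrpBin.add, ts, ih =>
      rw [show ts = ![ts 0, ts 1] by ext i; fin_cases i <;> rfl]
      exact hadd _ _ (ih 0) (ih 1)
    | 2, LGrpBin.join, ts, ih =>
      rw [show ts = ![ts 0, ts 1] by ext i; fin_cases i <;> rfl]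
      exact hsup _ _ (ih 0) (ih 1)
    | 2, LGrpBin.meet, ts, ih =>
      rw [show ts = ![ts 0, ts 1] by ext i; fin_cases i <;> rfl]
      exact hinf _ _ (ih 0) (ih 1)
    | (_ + 3), f, _, _ => exact f.elim

theorem realize_hom {G H : Type*} [Lattice G] [AddCommGroup G] [AddLeftMono G]
    [Lattice H] [AddCommGroup H] [AddLeftMono H] (f : G →+ H)
    (hf : ∀ x y, f (x ⊔ y) = f x ⊔ f y) (v : α → G) (t : LGrpLang.Term α) :
    t.realize (fun i => f (v i)) = f (t.realize v) := by
  induction t using induction with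
  | hvar i => rfl
  | hzero => simp
  | hneg t ht => simp [ht]
  | hadd t u ht hu => simp [ht, hu]
  | hsup t u ht hu => simp [ht, hu, hf]
  | hinf t u ht hu =>
    have h (x y : G) : f (x ⊓ y) = f x ⊓ f y := by
      rw [← neg_neg (x ⊓ y), neg_inf, map_neg, hf, neg_sup, map_neg, map_neg, neg_neg, neg_neg]
    simp [ht, hu, h]

theorem realize_zero_val {G : Type*} [Lattice G] [AddCommGroup G] [AddLeftMono G]
    (t : LGrpLang.Term α) : t.realize (0 : α → G) = 0 := by
  exact realize_hom (0 : G →+ G) (by simp) (0 : α → G) t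

theorem realize_nsmul {T : Type*} [LinearOrder T] [AddCommGroup T] [IsOrderedAddMonoid T]
    (N : ℕ) (v : α → T) (t : LGrpLang.Term α) :
    t.realize (N • v) = N • t.realize v :=
  realize_hom (nsmulAddMonoidHom N)
    (fun _ _ => (show Monotone (fun x : T => N • x) from
      fun _ _ h => nsmul_le_nsmul_right h N).map_sup _ _) v t

/-- The term `n t` for a natural number `n`. -/
def nsmul (t : LGrpLang.Term α) : ℕ → LGrpLang.Term α
  | 0 => zero
  | n + 1 => add (nsmul t n) t

/-- The term `n t` for an integer `n`. -/
def zsmul (n : ℤ) (t : LGrpLang.Term α) : LGrpLang.Term α :=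
  if 0 ≤ n then nsmul t n.natAbs else neg (nsmul t n.natAbs)

@[simp] theorem realize_nsmul_term {G : Type*} [Lattice G] [AddCommGroup G] (v : α → G)
    (t : LGrpLang.Term α) (n : ℕ) : (nsmul t n).realize v = n • t.realize v := by
  induction n with
  | zero => simp [nsmul]
  | succ n ih => simp [nsmul, ih, succ_nsmul]

@[simp] theorem realize_zsmul {G : Type*} [Lattice G] [AddCommGroup G] (v : α → G)
    (n : ℤ) (t : LGrpLang.Term α) : (zsmul n t).realize v = n • t.realize v := by
  unfold zsmul
  split_ifs with h
  · rw [realize_nsmul_term, ← natCast_zsmul, Int.natAbs_of_nonneg h]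
  · rw [realize_neg, realize_nsmul_term, ← natCast_zsmul, Int.ofNat_natAbs_of_nonpos (by omega)]
    simp

end LGrpTerm

/-- The value at `v` of the integral linear form with the given coefficients. -/
def intForm {V T : Type*} [Fintype V] [AddCommGroup T] (v : V → T) : (V → ℤ) →+ T where
  toFun a := ∑ i, a i • v i
  map_zero' := by simp
  map_add' a b := by simp [add_smul, Finset.sum_add_distrib]

section IntForm

variable {V T : Type*} [Fintype V] [AddCommGroup T]

theorem intForm_apply (v : V → T) (a : V → ℤ) : intForm v a = ∑ i, a i • v i := rfl

theorem intForm_add (v w : V → T) (a : V → ℤ) :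
    intForm (v + w) a = intForm v a + intForm w a := by
  simp [intForm_apply, Finset.sum_add_distrib]

theorem intForm_zero (a : V → ℤ) : intForm (0 : V → T) a = 0 := by
  simp [intForm_apply]

theorem intForm_zsmul (n : ℤ) (v : V → T) (a : V → ℤ) :
    intForm (n • v) a = n • intForm v a := by
  simp [intForm_apply, Finset.smul_sum, smul_comm n]

theorem intForm_nsmul (n : ℕ) (v : V → T) (a : V → ℤ) :
    intForm (n • v) a = n • intForm v a := by
  simp [intForm_apply, Finset.smul_sum, smul_comm n]

@[simp] theorem intForm_single [DecidableEq V] (v : V → T) (i : V) (n : ℤ) :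
    intForm v (Pi.single i n) = n • v i := by
  simp [intForm_apply, Pi.single_apply]

theorem intForm_nonneg_of_mem_closure [LinearOrder T] [IsOrderedAddMonoid T] {v : V → T}
    {S : Set (V → ℤ)} (hS : ∀ a ∈ S, 0 ≤ intForm v a) {b : V → ℤ}
    (hb : b ∈ AddSubmonoid.closure S) : 0 ≤ intForm v b :=
  AddSubmonoid.closure_le (S := (AddSubmonoid.nonneg T).comap (intForm v)) |>.2 hS hb

/-- An integral form of Farkas' lemma. -/
theorem farkas (l : List (V → ℤ)) (b : V → ℤ)
    (h : ∀ w : V → ℤ, (∀ a ∈ l, 0 ≤ intForm w a) → 0 ≤ intForm w b) :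
    ∃ N : ℕ, 0 < N ∧ N • b ∈ AddSubmonoid.closure {a | a ∈ l} := by
  classical
  induction hn : l.length generalizing l b with
  | zero =>
    obtain rfl := List.length_eq_zero_iff.1 hn
    refine ⟨1, one_pos, ?_⟩
    have hb : b = 0 := by
      ext i
      have h1 := h (Pi.single i 1) (by simp)
      have h2 := h (Pi.single i (-1)) (by simp)
      simp only [intForm_apply, Pi.single_apply, smul_eq_mul, mul_ite, mul_one, mul_neg, mul_zero,
        Finset.sum_ite_eq', Finset.mem_univ, if_true] at h1 h2
      simp only [Pi.zero_apply]
      omega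
    simp [hb]
  | succ n ih =>
    obtain ⟨c, l, rfl⟩ := List.exists_cons_of_length_eq_add_one hn
    simp only [List.length_cons, Nat.add_right_cancel_iff] at hn
    have hsub : AddSubmonoid.closure {a | a ∈ l} ≤ AddSubmonoid.closure {a | a ∈ c :: l} :=
      AddSubmonoid.closure_mono fun a ha => List.mem_cons_of_mem c ha
    by_cases hl : ∀ w : V → ℤ, (∀ a ∈ l, 0 ≤ intForm w a) → 0 ≤ intForm w b
    · obtain ⟨N, hN, hmem⟩ := ih l b hl hn
      exact ⟨N, hN, hsub hmem⟩
    push Not at hl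
    obtain ⟨y, hy, hyb⟩ := hl
    have hyc : intForm y c < 0 := by
      by_contra! hc
      exact hyb.not_ge (h y (by simpa using ⟨hc, hy⟩))
    obtain ⟨s, hs⟩ := Int.eq_ofNat_of_zero_le (neg_nonneg.2 hyc.le)
    let p : (V → ℤ) → (V → ℤ) := fun a => s • a + intForm y a • c
    have hp (w a : V → ℤ) : intForm w (p a) = intForm (s • w + intForm w c • y) a := by
      simp only [p, map_add, map_nsmul, map_zsmul, intForm_add, intForm_nsmul, intForm_zsmul]
      simp only [smul_eq_mul]
      ring
    obtain ⟨N, hN, hmem⟩ := ih (l.map p) (p b) (by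
      intro w hw
      rw [hp]
      refine h _ ?_
      intro a ha
      rcases List.mem_cons.1 ha with rfl | ha
      · rw [← hp]
        simp only [p, map_add, map_nsmul, map_zsmul, smul_eq_mul]
        rw [nsmul_eq_mul, ← hs]
        apply le_of_eq
        ring
      · rw [← hp]
        exact hw _ (List.mem_map_of_mem ha)) (by simpa using hn)
    have hc : c ∈ AddSubmonoid.closure {a | a ∈ c :: l} :=
      AddSubmonoid.subset_closure (by simp)
    have hle : AddSubmonoid.closure {a | a ∈ l.map p} ≤ AddSubmonoid.closure {a | a ∈ c :: l} := by
      rw [AddSubmonoid.closure_le]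
      intro a' ha'
      obtain ⟨a, ha, rfl⟩ := List.mem_map.1 ha'
      obtain ⟨r, hr⟩ := Int.eq_ofNat_of_zero_le (hy a ha)
      simp only [p, hr, natCast_zsmul]
      exact add_mem (nsmul_mem (hsub (AddSubmonoid.subset_closure ha)) _) (nsmul_mem hc _)
    obtain ⟨r, hr⟩ := Int.eq_ofNat_of_zero_le (neg_nonneg.2 hyb.le)
    refine ⟨N * s, Nat.mul_pos hN (by omega), ?_⟩
    have heq : (N * s) • b = N • p b + (N * r) • c := by
      have hb : intForm y b = -(r : ℤ) := by rw [← neg_neg (intForm y b), hr]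
      simp only [p, hb, neg_smul, natCast_zsmul, mul_smul, smul_add, smul_neg]
      abel
    rw [heq]
    exact add_mem (hle hmem) (nsmul_mem hc _)

/-- Finitely many linear inequalities in an ordered group can be realized over `ℤ`. -/
theorem exists_int_approx [LinearOrder T] [IsOrderedAddMonoid T] (v : V → T)
    (D : List (V → ℤ)) :
    ∃ w : V → ℤ, ∀ a ∈ D,
      (0 ≤ intForm v a → 0 ≤ intForm w a) ∧ (0 < intForm v a → 0 < intForm w a) := by
  classical
  let D₀ := D.filter fun a => 0 ≤ intForm v a
  have hD₀ {a : V → ℤ} : a ∈ D₀ ↔ a ∈ D ∧ 0 ≤ intForm v a := by simp [D₀]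
  have key (a : V → ℤ) (ha : 0 < intForm v a) :
      ∃ w : V → ℤ, (∀ a ∈ D₀, 0 ≤ intForm w a) ∧ 0 < intForm w a := by
    by_contra! hw
    obtain ⟨N, hN, hmem⟩ := farkas D₀ (-a) fun w h => by
      rw [map_neg]
      exact neg_nonneg.2 (hw w h)
    have := intForm_nonneg_of_mem_closure (v := v) (fun a ha => (hD₀.1 ha).2) hmem
    rw [map_nsmul, map_neg, smul_neg, neg_nonneg] at this
    exact this.not_gt (nsmul_pos ha hN.ne')
  have sum (E : List (V → ℤ)) (hE : ∀ a ∈ E, a ∈ D ∧ 0 < intForm v a) :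
      ∃ w : V → ℤ, (∀ a ∈ D₀, 0 ≤ intForm w a) ∧ ∀ a ∈ E, 0 < intForm w a := by
    induction E with
    | nil => exact ⟨0, by simp [intForm_zero], by simp⟩
    | cons a E ih =>
      obtain ⟨w, hw, hwE⟩ := ih fun b hb => hE b (List.mem_cons_of_mem a hb)
      obtain ⟨w', hw', hwa⟩ := key a (hE a List.mem_cons_self).2
      refine ⟨w + w', fun b hb => ?_, fun b hb => ?_⟩
      · rw [intForm_add]
        exact add_nonneg (hw b hb) (hw' b hb)
      · have hbD := hE b hb
        rw [intForm_add]
        rcases List.mem_cons.1 hb with rfl | hb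
        · exact add_pos_of_nonneg_of_pos (hw b (hD₀.2 ⟨hbD.1, hbD.2.le⟩)) hwa
        · exact add_pos_of_pos_of_nonneg (hwE b hb) (hw' b (hD₀.2 ⟨hbD.1, hbD.2.le⟩))
  obtain ⟨w, hw, hwE⟩ := sum (D.filter fun a => 0 < intForm v a) (by simp)
  exact ⟨w, fun a ha => ⟨fun h => hw a (hD₀.2 ⟨ha, h⟩), fun h => hwE a (by simpa using ⟨ha, h⟩)⟩⟩

end IntForm

section Piecewise

variable {V : Type*} [Fintype V]

/-- A function of a `V`-tuple, defined uniformly in all totally ordered abelian groups. -/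
abbrev OrderedGroupFun (V : Type*) : Type _ :=
  ∀ (T : Type) [AddCommGroup T] [LinearOrder T] [IsOrderedAddMonoid T], (V → T) → T

/-- Piecewise linear functions with integral coefficients: finitely many polyhedral cones cover
the space, and the function is given by a linear form on each of them. -/
def IsPiecewise (F : OrderedGroupFun V) : Prop :=
  ∃ (ι : Type) (_ : Finite ι) (C : ι → List (V → ℤ)) (f : ι → V → ℤ),
    ∀ (T : Type) [AddCommGroup T] [LinearOrder T] [IsOrderedAddMonoid T] (v : V → T),
      (∃ i, ∀ a ∈ C i, 0 ≤ intForm v a) ∧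
        ∀ i, (∀ a ∈ C i, 0 ≤ intForm v a) → F T v = intForm v (f i)

namespace IsPiecewise

theorem linear (a : V → ℤ) : IsPiecewise (fun _ _ _ _ v => intForm v a) :=
  ⟨Unit, inferInstance, fun _ => [], fun _ => a, fun _ _ _ _ _ => ⟨⟨(), by simp⟩, by simp⟩⟩

variable {F G : OrderedGroupFun V}

theorem neg (hF : IsPiecewise F) : IsPiecewise (fun T _ _ _ v => -F T v) := by
  obtain ⟨ι, hι, C, f, h⟩ := hF
  refine ⟨ι, hι, C, fun i => -f i, fun T _ _ _ v => ⟨(h T v).1, fun i hi => ?_⟩⟩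
  simp only [(h T v).2 i hi, map_neg]

theorem add (hF : IsPiecewise F) (hG : IsPiecewise G) :
    IsPiecewise (fun T _ _ _ v => F T v + G T v) := by
  obtain ⟨ι, hι, C, f, hF⟩ := hF
  obtain ⟨κ, hκ, D, g, hG⟩ := hG
  refine ⟨ι × κ, inferInstance, fun p => C p.1 ++ D p.2, fun p => f p.1 + g p.2,
    fun T _ _ _ v => ⟨?_, fun p hp => ?_⟩⟩
  · obtain ⟨i, hi⟩ := (hF T v).1
    obtain ⟨j, hj⟩ := (hG T v).1
    exact ⟨(i, j), by simpa [or_imp, forall_and] using ⟨hi, hj⟩⟩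
  · simp only [List.mem_append, or_imp, forall_and] at hp
    simp only [(hF T v).2 _ hp.1, (hG T v).2 _ hp.2, map_add]

theorem sup (hF : IsPiecewise F) (hG : IsPiecewise G) :
    IsPiecewise (fun T _ _ _ v => F T v ⊔ G T v) := by
  obtain ⟨ι, hι, C, f, hF⟩ := hF
  obtain ⟨κ, hκ, D, g, hG⟩ := hG
  refine ⟨(ι × κ) ⊕ (ι × κ), inferInstance,
    Sum.elim (fun p => (f p.1 - g p.2) :: (C p.1 ++ D p.2))
      (fun p => (g p.2 - f p.1) :: (C p.1 ++ D p.2)),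
    Sum.elim (fun p => f p.1) (fun p => g p.2), fun T _ _ _ v => ⟨?_, ?_⟩⟩
  · obtain ⟨i, hi⟩ := (hF T v).1
    obtain ⟨j, hj⟩ := (hG T v).1
    rcases le_total (intForm v (g j)) (intForm v (f i)) with h | h
    · exact ⟨.inl (i, j), by simpa [or_imp, forall_and] using ⟨h, hi, hj⟩⟩
    · exact ⟨.inr (i, j), by simpa [or_imp, forall_and] using ⟨h, hi, hj⟩⟩
  · rintro (p | p) hp <;>
    · simp only [Sum.elim_inl, Sum.elim_inr, List.mem_cons, List.mem_append, or_imp, forall_and,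
        forall_eq, map_sub, sub_nonneg] at hp ⊢
      rw [(hF T v).2 _ hp.2.1, (hG T v).2 _ hp.2.2]
      simp [hp.1]

theorem sub (hF : IsPiecewise F) (hG : IsPiecewise G) :
    IsPiecewise (fun T _ _ _ v => F T v - G T v) := by
  simpa only [sub_eq_add_neg] using hF.add hG.neg

theorem abs (hF : IsPiecewise F) : IsPiecewise (fun T _ _ _ v => |F T v|) :=
  hF.sup hF.neg

theorem sum {κ : Type*} (s : Finset κ) {F : κ → OrderedGroupFun V}
    (hF : ∀ k, IsPiecewise (F k)) : IsPiecewise (fun T _ _ _ v => ∑ k ∈ s, F k T v) := by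
  classical
  induction s using Finset.induction_on with
  | empty => simpa using linear (0 : V → ℤ)
  | insert k s hk ih => simpa only [Finset.sum_insert hk] using (hF k).add ih

theorem realize (t : LGrpLang.Term V) : IsPiecewise (fun _ _ _ _ v => t.realize v) := by
  classical
  induction t using LGrpTerm.induction with
  | hvar i => simpa using linear (Pi.single i 1 : V → ℤ)
  | hzero => simpa using linear (0 : V → ℤ)
  | hneg t ht => exact ht.neg
  | hadd t u ht hu => exact ht.add hu
  | hsup t u ht hu => exact ht.sup hu
  | hinf t u ht hu =>
    have := (ht.neg.sup hu.neg).neg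
    simp only [neg_sup, neg_neg] at this
    exact this

theorem exists_int_eq_zero_iff {κ : Type*} [Finite κ] {F : κ → OrderedGroupFun V}
    (hF : ∀ k, IsPiecewise (F k)) (T : Type) [AddCommGroup T] [LinearOrder T]
    [IsOrderedAddMonoid T] (v : V → T) :
    ∃ w : V → ℤ, ∀ k, F k ℤ w = 0 ↔ F k T v = 0 := by
  have := Fintype.ofFinite κ
  choose ι hι C f h using hF
  choose p hp using fun k => (h k T v).1
  obtain ⟨w, hw⟩ := exists_int_approx v
    ((Finset.univ : Finset κ).toList.flatMap fun k => f k (p k) :: -f k (p k) :: C k (p k))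
  refine ⟨w, fun k => ?_⟩
  have hw' : ∀ a ∈ f k (p k) :: -f k (p k) :: C k (p k), _ := fun a ha =>
    hw a (List.mem_flatMap.2 ⟨k, by simp, ha⟩)
  rw [(h k T v).2 (p k) (hp k), (h k ℤ w).2 (p k) fun a ha =>
    (hw' a (by simp [ha])).1 (hp k a ha)]
  have h₁ := (hw' (f k (p k)) (by simp)).2
  have h₂ := (hw' (-f k (p k)) (by simp)).2
  have h₃ := (hw' (f k (p k)) (by simp)).1
  have h₄ := (hw' (-f k (p k)) (by simp)).1
  simp only [map_neg, neg_pos, neg_nonneg] at h₂ h₄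
  constructor
  · intro h0
    by_contra hne
    rcases lt_or_gt_of_ne hne with hlt | hlt
    · exact (h₂ hlt).ne h0
    · exact (h₁ hlt).ne' h0
  · intro h0
    exact le_antisymm (h₄ h0.le) (h₃ h0.ge)

end IsPiecewise

/-- The integral solution set of a finite system of equations is a finite union of cones. -/
theorem exists_cones {κ : Type*} [Finite κ] (s t : κ → LGrpLang.Term V) :
    ∃ (ι : Type) (_ : Finite ι) (C : ι → List (V → ℤ)), ∀ w : V → ℤ,
      (∀ k, (s k).realize w = (t k).realize w) ↔ ∃ i, ∀ a ∈ C i, 0 ≤ intForm w a := by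
  have := Fintype.ofFinite κ
  obtain ⟨ι, hι, C, f, h⟩ := IsPiecewise.sum Finset.univ fun k =>
    ((IsPiecewise.realize (s k)).sub (IsPiecewise.realize (t k))).abs
  refine ⟨ι, hι, fun i => f i :: -f i :: C i, fun w => ?_⟩
  have hsum : (∀ k, (s k).realize w = (t k).realize w) ↔
      ∑ k, |(s k).realize w - (t k).realize w| = 0 := by
    rw [Finset.sum_eq_zero_iff_of_nonneg fun _ _ => abs_nonneg _]
    simp [sub_eq_zero]
  obtain ⟨⟨i, hi⟩, hf⟩ := h ℤ w
  beta_reduce at hf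
  simp only [hsum, List.mem_cons, or_imp, forall_and, forall_eq, map_neg, neg_nonneg]
  constructor
  · intro h0
    rw [hf i hi] at h0
    exact ⟨i, h0.ge, h0.le, hi⟩
  · rintro ⟨j, hj₁, hj₂, hj⟩
    rw [hf j hj]
    exact le_antisymm hj₂ hj₁

/-- A quasi-identity valid in `ℤ` is valid in every abelian `ℓ`-group. -/
theorem quasiIdentity_of_int {κ : Type*} [Finite κ] (s t : κ → LGrpLang.Term V)
    (s₀ t₀ : LGrpLang.Term V)
    (h : ∀ w : V → ℤ, (∀ k, (s k).realize w = (t k).realize w) → s₀.realize w = t₀.realize w)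
    {G : Type} [Lattice G] [AddCommGroup G] [AddLeftMono G] (v : V → G)
    (hv : ∀ k, (s k).realize v = (t k).realize v) : s₀.realize v = t₀.realize v := by
  by_contra hne
  obtain ⟨T, _, _, _, f, hf, hne⟩ := exists_hom_linearOrder (sub_ne_zero.2 hne)
  obtain ⟨w, hw⟩ := IsPiecewise.exists_int_eq_zero_iff (κ := Option κ)
    (F := fun k T _ _ _ v => (k.elim s₀ s).realize v - (k.elim t₀ t).realize v)
    (fun k => (IsPiecewise.realize _).sub (IsPiecewise.realize _)) T (fun i => f (v i))
  simp only [sub_eq_zero, LGrpTerm.realize_hom f hf] at hw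
  refine hne ?_
  rw [map_sub, sub_eq_zero]
  exact (hw none).1 (h w fun k => (hw (some k)).2 (congrArg f (hv k)))

end Piecewise

section Cone

variable {V X Z : Type*} [Fintype V] [Fintype X] [Fintype Z]

/-- The integral points of the cone cut out by finitely many integral linear forms. -/
def intCone (C : List (V → ℤ)) : AddSubmonoid (V → ℤ) where
  carrier := {w | ∀ a ∈ C, 0 ≤ intForm w a}
  zero_mem' a _ := (intForm_zero a).ge
  add_mem' hv hw a ha := by
    rw [intForm_add]
    exact add_nonneg (hv a ha) (hw a ha)

theorem intForm_sumElim {T : Type*} [AddCommGroup T] (x : X → T) (z : Z → T) (a : X ⊕ Z → ℤ) :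
    intForm (Sum.elim x z) a = intForm x (a ∘ Sum.inl) + intForm z (a ∘ Sum.inr) := by
  simp [intForm_apply, Fintype.sum_sum_type]

/-- If `0 ≤ α + β` holds on the fibre product over `X` of two cones, then some linear form on `X`
separates multiples of `α` and `-β`. -/
theorem exists_interpolant (A B : List (X ⊕ Z → ℤ)) (α β : X ⊕ Z → ℤ)
    (h : ∀ x z z', Sum.elim x z ∈ intCone A → Sum.elim x z' ∈ intCone B →
      0 ≤ intForm (Sum.elim x z) α + intForm (Sum.elim x z') β) :
    ∃ N : ℕ, 0 < N ∧ ∃ e : X → ℤ,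
      (∀ x z, Sum.elim x z ∈ intCone A → intForm x e ≤ N • intForm (Sum.elim x z) α) ∧
      ∀ x z, Sum.elim x z ∈ intCone B → -(N • intForm (Sum.elim x z) β) ≤ intForm x e := by
  let f : (X ⊕ Z → ℤ) →+ (X ⊕ Z ⊕ Z → ℤ) :=
    { toFun := fun a => Sum.elim (a ∘ Sum.inl) (Sum.elim (a ∘ Sum.inr) 0)
      map_zero' := by ext (i | i | i) <;> rfl
      map_add' := fun a b => by ext (i | i | i) <;> simp }
  let g : (X ⊕ Z → ℤ) →+ (X ⊕ Z ⊕ Z → ℤ) :=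
    { toFun := fun a => Sum.elim (a ∘ Sum.inl) (Sum.elim 0 (a ∘ Sum.inr))
      map_zero' := by ext (i | i | i) <;> rfl
      map_add' := fun a b => by ext (i | i | i) <;> simp }
  have hf (x : X → ℤ) (z z' : Z → ℤ) (a) :
      intForm (Sum.elim x (Sum.elim z z')) (f a) = intForm (Sum.elim x z) a := by
    simp [intForm_apply, f]
  have hg (x : X → ℤ) (z z' : Z → ℤ) (a) :
      intForm (Sum.elim x (Sum.elim z z')) (g a) = intForm (Sum.elim x z') a := by
    simp [intForm_apply, g]
  obtain ⟨N, hN, hmem⟩ := farkas (A.map f ++ B.map g) (f α + g β) fun w hw => by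
    obtain ⟨x, z, z', rfl⟩ : ∃ x z z', w = Sum.elim x (Sum.elim z z') :=
      ⟨w ∘ Sum.inl, w ∘ Sum.inr ∘ Sum.inl, w ∘ Sum.inr ∘ Sum.inr,
        by ext (i | i | i) <;> rfl⟩
    rw [map_add, hf, hg]
    refine h x z z' (fun a ha => ?_) fun a ha => ?_
    · rw [← hf x z z']
      exact hw _ (List.mem_append_left _ (List.mem_map_of_mem ha))
    · rw [← hg x z z']
      exact hw _ (List.mem_append_right _ (List.mem_map_of_mem ha))
  have hset : {a | a ∈ A.map f ++ B.map g} = f '' {a | a ∈ A} ∪ g '' {a | a ∈ B} := by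
    ext
    simp
  rw [hset, AddSubmonoid.closure_union, ← AddMonoidHom.map_mclosure, ← AddMonoidHom.map_mclosure,
    AddSubmonoid.mem_sup] at hmem
  obtain ⟨_, ⟨p, hp, rfl⟩, _, ⟨q, hq, rfl⟩, hpq⟩ := hmem
  have hX : p ∘ Sum.inl + q ∘ Sum.inl = N • (α ∘ Sum.inl + β ∘ Sum.inl) :=
    funext fun i => congrFun hpq (Sum.inl i)
  have hZ : p ∘ Sum.inr = N • (α ∘ Sum.inr) := funext fun i => by
    simpa [f, g] using congrFun hpq (Sum.inr (Sum.inl i))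
  have hZ' : q ∘ Sum.inr = N • (β ∘ Sum.inr) := funext fun i => by
    simpa [f, g] using congrFun hpq (Sum.inr (Sum.inr i))
  refine ⟨N, hN, N • (α ∘ Sum.inl) - p ∘ Sum.inl, fun x z hz => ?_, fun x z hz => ?_⟩
  · have := intForm_nonneg_of_mem_closure hz hp
    rw [intForm_sumElim, hZ, map_nsmul] at this
    rw [intForm_sumElim, map_sub, map_nsmul, smul_add]
    linarith
  · have := intForm_nonneg_of_mem_closure hz hq
    rw [intForm_sumElim, hZ', map_nsmul] at this
    have hX' := congrArg (intForm x) hX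
    rw [map_add, map_nsmul, map_add, smul_add] at hX'
    rw [intForm_sumElim, map_sub, map_nsmul, smul_add]
    linarith

/-- A linear form which is divisible by `M` on a saturated submonoid agrees there with `M` times
some linear form. -/
theorem exists_intForm_of_dvd (P : AddSubmonoid (X → ℤ))
    (hP : ∀ (N : ℕ) x, 0 < N → N • x ∈ P → x ∈ P) {M : ℤ} (h : X → ℤ)
    (hM : ∀ x ∈ P, M ∣ intForm x h) :
    ∃ g : X → ℤ, ∀ x ∈ P, M * intForm x g = intForm x h := by
  classical
  let L : Submodule ℤ (X → ℤ) :=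
    AddSubgroup.toIntSubmodule
      { carrier := {x | ∃ b ∈ P, x + b ∈ P}
        zero_mem' := ⟨0, P.zero_mem, by simp [P.zero_mem]⟩
        add_mem' := by
          rintro x y ⟨b, hb, hxb⟩ ⟨c, hc, hyc⟩
          exact ⟨b + c, P.add_mem hb hc, by
            rw [add_add_add_comm]
            exact P.add_mem hxb hyc⟩
        neg_mem' := by
          rintro x ⟨b, hb, hxb⟩
          exact ⟨x + b, hxb, by simpa using hb⟩ }
  have hL {x : X → ℤ} : x ∈ L ↔ ∃ b ∈ P, x + b ∈ P := Iff.rfl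
  have hPL {x : X → ℤ} (hx : x ∈ P) : x ∈ L := hL.2 ⟨0, P.zero_mem, by simpa using hx⟩
  have hML {x : X → ℤ} (hx : x ∈ L) : M ∣ intForm x h := by
    obtain ⟨b, hb, hxb⟩ := hL.1 hx
    have := dvd_sub (hM _ hxb) (hM _ hb)
    rwa [intForm_add, add_sub_cancel_right] at this
  have hsatN {N : ℕ} {x : X → ℤ} (hN : 0 < N) (hx : N • x ∈ L) : x ∈ L := by
    obtain ⟨b, hb, hxb⟩ := hL.1 hx
    refine hL.2 ⟨b, hb, hP N _ hN ?_⟩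
    obtain ⟨N, rfl⟩ := Nat.exists_eq_succ_of_ne_zero hN.ne'
    have : (N + 1) • (x + b) = ((N + 1) • x + b) + N • b := by
      rw [smul_add, succ_nsmul b]
      abel
    rw [Nat.succ_eq_add_one, this]
    exact P.add_mem hxb (P.nsmul_mem hb N)
  have hsat {n : ℤ} {x : X → ℤ} (hn : n ≠ 0) (hx : n • x ∈ L) : x ∈ L := by
    refine hsatN (Int.natAbs_pos.2 hn) ?_
    rcases Int.natAbs_eq n with h | h
    · rwa [h, natCast_zsmul] at hx
    · rw [h, neg_smul, natCast_zsmul] at hx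
      exact neg_mem_iff.1 hx
  have : Module.IsTorsionFree ℤ ((X → ℤ) ⧸ L) := by
    refine .of_smul_eq_zero fun n q hq => ?_
    obtain ⟨x, rfl⟩ := L.mkQ_surjective q
    rw [← map_smul, Submodule.mkQ_apply, Submodule.Quotient.mk_eq_zero] at hq
    by_cases hn : n = 0
    · exact .inl hn
    · exact .inr ((Submodule.Quotient.mk_eq_zero L).2 (hsat hn hq))
  have : Module.Free ℤ ((X → ℤ) ⧸ L) := inferInstance
  obtain ⟨s, hs⟩ := Module.projective_lifting_property L.mkQ LinearMap.id L.mkQ_surjective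
  let r : (X → ℤ) →ₗ[ℤ] (X → ℤ) := LinearMap.id - s ∘ₗ L.mkQ
  have hr (x) : r x ∈ L := by
    rw [← Submodule.Quotient.mk_eq_zero, ← Submodule.mkQ_apply]
    have := LinearMap.congr_fun hs (L.mkQ x)
    simp only [LinearMap.comp_apply, LinearMap.id_apply] at this
    rw [LinearMap.sub_apply, map_sub, LinearMap.comp_apply, this, LinearMap.id_apply, sub_self]
  have hrP {x} (hx : x ∈ P) : r x = x := by
    have : L.mkQ x = 0 := (Submodule.Quotient.mk_eq_zero L).2 (hPL hx)
    simp [r, this]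
  let F : (X → ℤ) →ₗ[ℤ] ℤ :=
    AddMonoidHom.toIntLinearMap
      { toFun := fun x => intForm x h
        map_zero' := intForm_zero h
        map_add' := fun x y => intForm_add x y h } ∘ₗ r
  refine ⟨fun i => F (fun j => if i = j then 1 else 0) / M, fun x hx => ?_⟩
  have hF : F x = intForm x h := congrArg (intForm · h) (hrP hx)
  rw [← hF, F.pi_apply_eq_sum_univ x, intForm_apply, Finset.mul_sum]
  refine Finset.sum_congr rfl fun i _ => ?_
  have := Int.mul_ediv_cancel' (show M ∣ F fun j => if i = j then 1 else 0 from hML (hr _))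
  rw [smul_eq_mul, smul_eq_mul, ← mul_assoc, this, mul_comm]

end Cone

section TermFunctions

variable (X : Type*)

/-- The term functions `(X → ℤ) → ℤ`. -/
def termFunctions : AddSubgroup ((X → ℤ) → ℤ) where
  carrier := {f | ∃ t : LGrpLang.Term X, ∀ x : X → ℤ, t.realize x = f x}
  zero_mem' := ⟨LGrpTerm.zero, fun _ => rfl⟩
  add_mem' := by
    rintro _ _ ⟨t, ht⟩ ⟨u, hu⟩
    exact ⟨LGrpTerm.add t u, fun x => by simp [ht, hu]⟩
  neg_mem' := by
    rintro _ ⟨t, ht⟩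
    exact ⟨LGrpTerm.neg t, fun x => by simp [ht]⟩

variable {X}

theorem sup_mem_termFunctions {f g : (X → ℤ) → ℤ} (hf : f ∈ termFunctions X)
    (hg : g ∈ termFunctions X) : f ⊔ g ∈ termFunctions X := by
  obtain ⟨t, ht⟩ := hf
  obtain ⟨u, hu⟩ := hg
  exact ⟨LGrpTerm.sup t u, fun x => by simp [ht, hu]⟩

theorem inf_mem_termFunctions {f g : (X → ℤ) → ℤ} (hf : f ∈ termFunctions X)
    (hg : g ∈ termFunctions X) : f ⊓ g ∈ termFunctions X := by
  obtain ⟨t, ht⟩ := hf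
  obtain ⟨u, hu⟩ := hg
  exact ⟨LGrpTerm.inf t u, fun x => by simp [ht, hu]⟩

theorem intForm_mem_termFunctions [Fintype X] (a : X → ℤ) :
    (fun x => intForm x a) ∈ termFunctions X := by
  have : (fun x => intForm x a) = ∑ i, a i • fun x : X → ℤ => x i := by
    ext x
    simp [intForm_apply]
  have hvar (i : X) : (fun x : X → ℤ => x i) ∈ termFunctions X := ⟨Term.var i, fun _ => rfl⟩
  rw [this]
  exact sum_mem fun i _ => zsmul_mem (hvar i) _

end TermFunctions

theorem sumElim_nsmul {X Z : Type*} (N : ℕ) (x : X → ℤ) (z : Z → ℤ) :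
    Sum.elim (N • x) (N • z) = N • Sum.elim x z := by
  ext (i | i) <;> rfl

theorem sumElim_add {X Z : Type*} (x y : X → ℤ) (z w : Z → ℤ) :
    Sum.elim (x + y) (z + w) = Sum.elim x z + Sum.elim y w := by
  ext (i | i) <;> rfl

section ConeRel

variable {ι X Z : Type*} [Fintype X] [Fintype Z]

/-- The relation whose graph is a union of cones. -/
def ConeRel (C : ι → List (X ⊕ Z → ℤ)) (x : X → ℤ) (z : Z → ℤ) : Prop :=
  ∃ i, Sum.elim x z ∈ intCone (C i)

variable {C : ι → List (X ⊕ Z → ℤ)}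

theorem ConeRel.nsmul {x : X → ℤ} {z : Z → ℤ} (h : ConeRel C x z) (N : ℕ) :
    ConeRel C (N • x) (N • z) := by
  obtain ⟨i, hi⟩ := h
  exact ⟨i, by simpa only [sumElim_nsmul] using (intCone (C i)).nsmul_mem hi N⟩

variable (hU : ∀ x z z', ConeRel C x z → ConeRel C x z' → z = z')
include hU

theorem exists_intForm_eq_nsmul (i : ι) (c : Z) :
    ∃ M : ℕ, 0 < M ∧ ∃ h : X → ℤ,
      ∀ x z, Sum.elim x z ∈ intCone (C i) → M * z c = intForm x h := by
  classical
  obtain ⟨M, hM, h, h₁, h₂⟩ := exists_interpolant (C i) (C i) (Pi.single (Sum.inr c) 1)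
    (-Pi.single (Sum.inr c) 1) fun x z z' hz hz' => by
      simp [hU x z z' ⟨i, hz⟩ ⟨i, hz'⟩]
  refine ⟨M, hM, h, fun x z hz => le_antisymm ?_ ?_⟩
  · simpa using h₂ x z hz
  · simpa using h₁ x z hz

/-- Each `x` has a rational solution; the denominators which occur form a finite set. -/
theorem exists_denominators [Finite ι]
    (hE : ∀ x, ∃ N : ℕ, 0 < N ∧ ∃ z, ConeRel C (N • x) z) :
    ∃ S : Finset ℕ,
      (∀ b ∈ S, 0 < b ∧ ∃ (x : X → ℤ) (c : Z) (a : ℤ), IsCoprime a b ∧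
        ∀ N : ℕ, 0 < N → ∀ z, ConeRel C (N • x) z → b * z c = N * a) ∧
      ∀ (x : X → ℤ) (c : Z), ∃ b ∈ S, ∃ a : ℤ,
        ∀ N : ℕ, 0 < N → ∀ z, ConeRel C (N • x) z → b * z c = N * a := by
  classical
  have := Fintype.ofFinite ι
  choose M hM h hh using exists_intForm_eq_nsmul hU
  let D (b : ℕ) : Prop := 0 < b ∧ ∃ (x : X → ℤ) (c : Z) (a : ℤ), IsCoprime a b ∧
    ∀ N : ℕ, 0 < N → ∀ z, ConeRel C (N • x) z → b * z c = N * a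
  refine ⟨{b ∈ (Finset.univ : Finset (ι × Z)).biUnion fun p => (M p.1 p.2).divisors | D b},
    fun b hb => (Finset.mem_filter.1 hb).2, fun x c => ?_⟩
  obtain ⟨N, hN, z, i, hz⟩ := hE x
  have hzM := hh i c _ _ hz
  rw [intForm_nsmul, nsmul_eq_mul] at hzM
  obtain ⟨g, a, b, hg, hab, ha, hb⟩ := Int.exists_gcd_one' (m := intForm x (h i c))
    (n := M i c) (Int.gcd_pos_of_ne_zero_right _ (by exact_mod_cast (hM i c).ne'))
  have hb0 : 0 < b := by
    have : (0 : ℤ) < b * g := hb ▸ by exact_mod_cast hM i c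
    exact pos_of_mul_pos_left this (by positivity)
  lift b to ℕ using hb0.le
  have key (N' : ℕ) (hN' : 0 < N') (z') (hz' : ConeRel C (N' • x) z') : b * z' c = N' * a := by
    have hzz : N' • z = N • z' := hU _ _ _ (ConeRel.nsmul ⟨i, hz⟩ N') <| by
      rw [smul_comm]
      exact hz'.nsmul N
    have hzz : (N' : ℤ) * z c = N * z' c := by simpa using congrFun hzz c
    rw [ha, hb] at hzM
    have hgN : (g * N : ℤ) ≠ 0 := by positivity
    refine mul_left_cancel₀ hgN ?_
    linear_combination (N' : ℤ) * hzM - b * g * hzz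
  refine ⟨b, Finset.mem_filter.2 ⟨?_, by exact_mod_cast hb0, x, c, a,
    Int.isCoprime_iff_gcd_eq_one.2 hab, key⟩, a, key⟩
  exact Finset.mem_biUnion.2 ⟨(i, c), Finset.mem_univ _,
    Nat.mem_divisors.2 ⟨⟨g, by exact_mod_cast hb⟩, (hM i c).ne'⟩⟩

theorem exists_intForm_eq_mul {k : ℤ} {c : Z}
    (hk : ∀ x : X → ℤ, ∃ w : ℤ, ∀ N : ℕ, 0 < N → ∀ z, ConeRel C (N • x) z → k * z c = N * w)
    (i : ι) : ∃ g : X → ℤ, ∀ x z, Sum.elim x z ∈ intCone (C i) → intForm x g = k * z c := by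
  obtain ⟨M, hM, h, hh⟩ := exists_intForm_eq_nsmul hU i c
  have hM' : (M : ℤ) ≠ 0 := by positivity
  let P : AddSubmonoid (X → ℤ) :=
    { carrier := {x | ∃ N : ℕ, 0 < N ∧ ∃ z, Sum.elim (N • x) z ∈ intCone (C i)}
      zero_mem' := ⟨1, one_pos, 0, by
        rw [smul_zero]
        convert (intCone (C i)).zero_mem
        ext (i | i) <;> rfl⟩
      add_mem' := by
        rintro x y ⟨N, hN, z, hz⟩ ⟨N', hN', z', hz'⟩
        refine ⟨N' * N, by positivity, N' • z + N • z', ?_⟩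
        rw [smul_add, mul_smul, mul_comm, mul_smul, sumElim_add, sumElim_nsmul, sumElim_nsmul]
        exact add_mem (nsmul_mem hz _) (nsmul_mem hz' _) }
  obtain ⟨g, hg⟩ := exists_intForm_of_dvd P (M := M)
    (by
      rintro N x hN ⟨N', hN', z, hz⟩
      exact ⟨N' * N, by positivity, z, by rwa [mul_smul]⟩)
    (k • h)
    (by
      rintro x ⟨N, hN, z, hz⟩
      obtain ⟨w, hw⟩ := hk x
      refine ⟨w, ?_⟩
      have hw := hw N hN z ⟨i, hz⟩
      have hz := hh _ _ hz
      rw [intForm_nsmul, nsmul_eq_mul] at hz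
      rw [map_zsmul, smul_eq_mul]
      refine mul_left_cancel₀ (show (N : ℤ) ≠ 0 by positivity) ?_
      linear_combination M * hw - k * hz)
  refine ⟨g, fun x z hz => mul_left_cancel₀ hM' ?_⟩
  rw [hg x ⟨1, one_pos, z, by rwa [one_smul]⟩, map_zsmul, ← hh x z hz, smul_eq_mul]
  ring

/-- If `z c` is, up to the factor `k`, an integral linear form on each cone, then it is
given by a term on the whole domain of the relation. -/
theorem exists_term_eq_mul [Finite ι] [Nonempty ι] {k : ℤ} {c : Z}
    (hk : ∀ x : X → ℤ, ∃ w : ℤ, ∀ N : ℕ, 0 < N → ∀ z, ConeRel C (N • x) z → k * z c = N * w) :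
    ∃ t : LGrpLang.Term X, ∀ (x : X → ℤ) z, ConeRel C x z → t.realize x = k * z c := by
  have := Fintype.ofFinite ι
  choose g hg using exists_intForm_eq_mul hU hk
  have pair (i j : ι) : ∃ f ∈ termFunctions X,
      (∀ x z, Sum.elim x z ∈ intCone (C i) → k * z c ≤ f x) ∧
      ∀ x z, Sum.elim x z ∈ intCone (C j) → f x ≤ k * z c := by
    obtain ⟨N, hN, e, hi, hj⟩ := exists_interpolant (C i) (C j) (Sum.elim (-g i) 0)
      (Sum.elim (g j) 0) fun x z z' hz hz' => by
        simp [intForm_sumElim, hg i x z hz, hg j x z' hz', hU x z z' ⟨i, hz⟩ ⟨j, hz'⟩]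
    simp only [intForm_sumElim, Sum.elim_comp_inl, Sum.elim_comp_inr, map_zero, add_zero,
      map_neg, smul_neg, nsmul_eq_mul] at hi hj
    refine ⟨(fun x => intForm x (g i)) +
      (0 ⊔ fun x => intForm x (g j - g i)) ⊓ (fun x => intForm x (-e - N • g i)),
      add_mem (intForm_mem_termFunctions _) (inf_mem_termFunctions
        (sup_mem_termFunctions (zero_mem _) (intForm_mem_termFunctions _))
        (intForm_mem_termFunctions _)), fun x z hz => ?_, fun x z hz => ?_⟩
    · have := hi x z hz
      have : 0 ≤ (0 ⊔ intForm x (g j - g i)) ⊓ intForm x (-e - N • g i) := by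
        refine le_inf le_sup_left ?_
        rw [map_sub, map_neg, map_nsmul, nsmul_eq_mul]
        linarith
      rw [← hg i x z hz]
      exact le_add_of_nonneg_right this
    · have := hj x z hz
      have : (0 ⊔ intForm x (g j - g i)) ⊓ intForm x (-e - N • g i) ≤
          intForm x (g j - g i) := by
        rcases le_total 0 (intForm x (g j - g i)) with h | h
        · rw [sup_of_le_right h]
          exact inf_le_left
        · refine inf_le_right.trans ?_
          rw [map_sub] at h
          rw [map_sub, map_sub, map_neg, map_nsmul, nsmul_eq_mul]
          have hN : (1 : ℤ) ≤ N := by exact_mod_cast hN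
          nlinarith
      rw [← hg j x z hz]
      rw [map_sub] at this
      change intForm x (g i) + (0 ⊔ intForm x (g j - g i)) ⊓ intForm x (-e - N • g i) ≤ _
      rw [map_sub]
      linarith
  choose f hf hfi hfj using pair
  obtain ⟨t, ht⟩ : (Finset.univ.inf' Finset.univ_nonempty fun j =>
      Finset.univ.sup' Finset.univ_nonempty fun i => f i j) ∈ termFunctions X :=
    Finset.inf'_mem (termFunctions X : Set ((X → ℤ) → ℤ))
      (fun _ h _ h' => inf_mem_termFunctions h h') _ _ _ fun j _ =>
      Finset.sup'_mem (termFunctions X : Set ((X → ℤ) → ℤ))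
        (fun _ h _ h' => sup_mem_termFunctions h h') _ _ _ fun i _ => hf i j
  refine ⟨t, ?_⟩
  rintro x z ⟨i, hi⟩
  rw [ht, Finset.inf'_apply]
  simp only [Finset.sup'_apply]
  refine le_antisymm ?_ ?_
  · exact (Finset.inf'_le _ (Finset.mem_univ i)).trans
      (Finset.sup'_le _ _ fun i' _ => hfj i' i x z hi)
  · exact Finset.le_inf' _ _ fun j _ =>
      (hfi i j x z hi).trans (Finset.le_sup' (fun i => f i j x) (Finset.mem_univ i))

end ConeRel

namespace LGrpTerm

/-- Substitute multiples of a single new variable for the variables on the left. -/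
def scaled {X Z : Type*} (x : X → ℤ) (t : LGrpLang.Term (X ⊕ Z)) : LGrpLang.Term (Option Z) :=
  t.subst (Sum.elim (fun l => zsmul (x l) (Term.var none)) fun c => Term.var (some c))

theorem realize_scaled {X Z G : Type*} [Lattice G] [AddCommGroup G] (x : X → ℤ)
    (t : LGrpLang.Term (X ⊕ Z)) (v : Option Z → G) :
    (scaled x t).realize v =
      t.realize (Sum.elim (fun l => x l • v none) fun c => v (some c)) := by
  rw [scaled, Term.realize_subst]
  congr 1
  ext (l | c) <;> simp

end LGrpTerm

theorem eq_of_nsmul_eq_nsmul {G : Type} [Lattice G] [AddCommGroup G] [AddLeftMono G] {k : ℕ}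
    (hk : 0 < k) {x y : G} (h : k • x = k • y) : x = y := by
  refine quasiIdentity_of_int (V := Bool) (κ := Unit)
    (fun _ => LGrpTerm.nsmul (Term.var true) k) (fun _ => LGrpTerm.nsmul (Term.var false) k)
    (Term.var true) (Term.var false) (fun w hw => ?_) (fun b => if b then x else y) ?_
  · have := hw ()
    simp only [LGrpTerm.realize_nsmul_term, Term.realize_var] at this
    exact nsmul_right_injective hk.ne' this
  · simpa using h

theorem exists_pos_of_nontrivial (A : Type*) [Lattice A] [AddCommGroup A] [AddLeftMono A]
    [Nontrivial A] : ∃ a : A, 0 < a := by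
  obtain ⟨y, hy⟩ := exists_ne (0 : A)
  by_contra! h
  refine hy ?_
  rw [← posPart_sub_negPart y, ← (posPart_nonneg y).eq_of_not_lt (h y⁺),
    ← (negPart_nonneg y).eq_of_not_lt (h y⁻), sub_zero]

namespace EFDSystem

variable {φ : EFDSystem LGrpLang}

/-- `z` solves the system with parameters `x`. -/
def IsSolution (φ : EFDSystem LGrpLang) {G : Type*} [Lattice G] [AddCommGroup G]
    (x : Fin φ.n → G) (z : Fin φ.m → G) : Prop :=
  ∀ i, (φ.lhs i).realize (Sum.elim x z) = (φ.rhs i).realize (Sum.elim x z)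

theorem isSolution_zero : φ.IsSolution (0 : Fin φ.n → ℤ) 0 := fun i => by
  have : Sum.elim (0 : Fin φ.n → ℤ) (0 : Fin φ.m → ℤ) = 0 := by
    ext (l | c) <;> rfl
  rw [this, LGrpTerm.realize_zero_val, LGrpTerm.realize_zero_val]

variable {A : Type} [Lattice A] [AddCommGroup A] [AddLeftMono A]

theorem Satisfies.isSolution_int_unique [Nontrivial A] (hA : φ.Satisfies A) (x : Fin φ.n → ℤ)
    (z z' : Fin φ.m → ℤ) (hz : φ.IsSolution x z) (hz' : φ.IsSolution x z') : z = z' := by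
  have : IsOrderedAddMonoid A := { add_le_add_left := fun _ _ h c => add_le_add_left h c }
  obtain ⟨a, ha⟩ := exists_pos_of_nontrivial A
  have hmono : StrictMono (fun n : ℤ => n • a) := zsmul_left_strictMono ha
  have hom (z : Fin φ.m → ℤ) (hz : φ.IsSolution x z) :
      φ.IsSolution (fun l => x l • a) (fun c => z c • a) := fun i => by
    have key (t : LGrpLang.Term (Fin φ.n ⊕ Fin φ.m)) :
        t.realize (Sum.elim (fun l => x l • a) fun c => z c • a) =
          t.realize (Sum.elim x z) • a := by
      rw [← zmultiplesHom_apply (β := A), ← LGrpTerm.realize_hom (zmultiplesHom A a)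
        fun _ _ => hmono.monotone.map_sup _ _]
      congr 1
      ext (l | c) <;> simp
    rw [key, key, hz i]
  have := (hA _).unique (hom z hz) (hom z' hz')
  exact funext fun c => hmono.injective (congrFun this c)

/-- A quasi-identity with the equations of the system at multiples of one nonnegative element
among its premises. -/
theorem eq_of_isSolution_zsmul (x : Fin φ.n → ℤ) (s t : LGrpLang.Term (Option (Fin φ.m)))
    (h : ∀ (N : ℕ) (z : Fin φ.m → ℤ), φ.IsSolution (N • x) z →
      s.realize (fun o => o.elim (N : ℤ) z) = t.realize (fun o => o.elim (N : ℤ) z))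
    {y : A} (hy : 0 ≤ y) {z : Fin φ.m → A} (hz : φ.IsSolution (fun l => x l • y) z) :
    s.realize (fun o => o.elim y z) = t.realize (fun o => o.elim y z) := by
  refine quasiIdentity_of_int
    (fun o : Option (Fin φ.r) => o.elim (LGrpTerm.sup (Term.var none) LGrpTerm.zero)
      fun i => LGrpTerm.scaled x (φ.lhs i))
    (fun o : Option (Fin φ.r) => o.elim (Term.var none) fun i => LGrpTerm.scaled x (φ.rhs i))
    s t (fun w hw => ?_) _ ?_
  · have hw0 : 0 ≤ w none := by simpa using hw none
    obtain ⟨N, hN⟩ := Int.eq_ofNat_of_zero_le hw0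
    have := h N (fun c => w (some c)) fun i => by
      have := hw (some i)
      simp only [Option.elim_some, LGrpTerm.realize_scaled] at this
      convert this using 3 <;> ext <;> simp [hN, mul_comm]
    convert this using 2 <;> ext (_ | _) <;> simp [hN]
  · rintro (_ | i)
    · simpa using hy
    · simpa [LGrpTerm.realize_scaled] using hz i

theorem Satisfies.exists_isSolution_nsmul [Nontrivial A] (hA : φ.Satisfies A) (x : Fin φ.n → ℤ) :
    ∃ N : ℕ, 0 < N ∧ ∃ z, φ.IsSolution (N • x) z := by
  obtain ⟨a, ha⟩ := exists_pos_of_nontrivial A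
  obtain ⟨z, hz, -⟩ := hA fun l => x l • a
  by_contra! h
  refine ha.ne' (eq_of_isSolution_zsmul x (Term.var none) LGrpTerm.zero
    (fun N w hw => ?_) ha.le hz)
  have hN : N = 0 := by
    by_contra hN
    exact h N (Nat.pos_of_ne_zero hN) w hw
  simp [hN]

/-- If `a / b` in lowest terms is the value of a coordinate of the rational solution for some
parameters, then the system forces divisibility by `b`. -/
theorem Satisfies.exists_nsmul_eq (hA : φ.Satisfies A) {a : ℤ} {b : ℕ} (hab : IsCoprime a b)
    {x : Fin φ.n → ℤ} {c : Fin φ.m}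
    (h : ∀ (N : ℕ) z, φ.IsSolution (N • x) z → b * z c = N * a) (y : A) :
    ∃ u : A, b • u = y := by
  have nonneg (y : A) (hy : 0 ≤ y) : ∃ u : A, b • u = y := by
    obtain ⟨z, hz, -⟩ := hA fun l => x l • y
    have hzc := eq_of_isSolution_zsmul x (LGrpTerm.nsmul (Term.var (some c)) b)
      (LGrpTerm.zsmul a (Term.var none)) (fun N w hw => by simpa [mul_comm a] using h N w hw) hy hz
    simp only [LGrpTerm.realize_nsmul_term, LGrpTerm.realize_zsmul, Term.realize_var,
      Option.elim_some, Option.elim_none] at hzc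
    obtain ⟨p, q, hpq⟩ := hab
    refine ⟨p • z c + q • y, ?_⟩
    rw [smul_add, smul_comm b p, hzc, smul_smul, ← natCast_zsmul, smul_smul, mul_comm (b : ℤ),
      ← add_smul, hpq, one_smul]
  obtain ⟨u, hu⟩ := nonneg y⁺ (posPart_nonneg y)
  obtain ⟨v, hv⟩ := nonneg y⁻ (negPart_nonneg y)
  exact ⟨u - v, by rw [smul_sub, hu, hv, posPart_sub_negPart]⟩

/-- Uniqueness of solutions is a quasi-identity. -/
theorem isSolution_unique
    (hU : ∀ (x : Fin φ.n → ℤ) z z', φ.IsSolution x z → φ.IsSolution x z' → z = z')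
    {x : Fin φ.n → A} {z z' : Fin φ.m → A} (hz : φ.IsSolution x z) (hz' : φ.IsSolution x z') :
    z = z' := by
  let f : Fin φ.n ⊕ Fin φ.m → Fin φ.n ⊕ Fin φ.m ⊕ Fin φ.m := Sum.map id Sum.inl
  let g : Fin φ.n ⊕ Fin φ.m → Fin φ.n ⊕ Fin φ.m ⊕ Fin φ.m := Sum.map id Sum.inr
  ext c
  refine quasiIdentity_of_int
    (Sum.elim (fun i => (φ.lhs i).relabel f) fun i => (φ.lhs i).relabel g)
    (Sum.elim (fun i => (φ.rhs i).relabel f) fun i => (φ.rhs i).relabel g)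
    (Term.var (Sum.inr (Sum.inl c))) (Term.var (Sum.inr (Sum.inr c))) (fun w hw => ?_)
    (Sum.elim x (Sum.elim z z')) ?_
  · obtain ⟨y, u, u', rfl⟩ : ∃ y u u', w = Sum.elim y (Sum.elim u u') :=
      ⟨w ∘ Sum.inl, w ∘ Sum.inr ∘ Sum.inl, w ∘ Sum.inr ∘ Sum.inr, by ext (i | i | i) <;> rfl⟩
    refine congrFun (hU y u u' (fun i => ?_) fun i => ?_) c
    · simpa [f, Term.realize_relabel, Sum.elim_comp_map] using hw (Sum.inl i)
    · simpa [g, Term.realize_relabel, Sum.elim_comp_map] using hw (Sum.inr i)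
  · rintro (i | i)
    · simpa [f, Term.realize_relabel, Sum.elim_comp_map] using hz i
    · simpa [g, Term.realize_relabel, Sum.elim_comp_map] using hz' i

/-- If integral solutions are given up to the factor `k` by terms, then in every abelian ℓ-group
any tuple which is given up to the factor `k` by these terms is a solution. -/
theorem isSolution_of_nsmul_eq {k : ℕ} (hk : 0 < k) (t : Fin φ.m → LGrpLang.Term (Fin φ.n))
    (ht : ∀ (x : Fin φ.n → ℤ) z, φ.IsSolution x z → ∀ c, (t c).realize x = k * z c)
    (hE : ∀ x : Fin φ.n → ℤ, ∃ N : ℕ, 0 < N ∧ ∃ z, φ.IsSolution (N • x) z)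
    {x : Fin φ.n → A} {z : Fin φ.m → A} (hz : ∀ c, k • z c = (t c).realize x) :
    φ.IsSolution x z := fun i => by
  refine quasiIdentity_of_int (fun c => LGrpTerm.nsmul (Term.var (Sum.inr c)) k)
    (fun c => (t c).relabel Sum.inl) _ _ (fun w hw => ?_) _ fun c => by simpa using hz c
  obtain ⟨y, u, rfl⟩ : ∃ y u, w = Sum.elim y u :=
    ⟨w ∘ Sum.inl, w ∘ Sum.inr, by ext (i | i) <;> rfl⟩
  obtain ⟨N, hN, u', hu'⟩ := hE y
  have hu (c) : u' c = N * u c := by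
    have h₁ := ht _ _ hu' c
    have h₂ := hw c
    rw [LGrpTerm.realize_nsmul] at h₁
    simp only [LGrpTerm.realize_nsmul_term, Term.realize_var, Sum.elim_inr, Term.realize_relabel,
      Sum.elim_comp_inl, nsmul_eq_mul] at h₁ h₂
    refine mul_left_cancel₀ (show (k : ℤ) ≠ 0 by positivity) ?_
    linear_combination -h₁ - (N : ℤ) * h₂
  obtain rfl : u' = N • u := funext fun c => by simp [hu]
  have := hu' i
  rw [sumElim_nsmul, LGrpTerm.realize_nsmul, LGrpTerm.realize_nsmul] at this
  exact nsmul_right_injective hN.ne' this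

end EFDSystem

/-- Every EFD-sentence with a nontrivial abelian ℓ-group model is equivalent, over all
abelian ℓ-groups, to `δ_k : ∀ x ∃! z, k z = x` for some positive integer `k`. -/
theorem efd_equiv_delta_k (φ : EFDSystem LGrpLang)
    (A : Type) [Lattice A] [AddCommGroup A] [CovariantClass A A (· + ·) (· ≤ ·)]
    [Nontrivial A] (hA : φ.Satisfies A) :
    ∃ k : ℕ, 0 < k ∧
      ∀ (G : Type) [Lattice G] [AddCommGroup G] [CovariantClass G G (· + ·) (· ≤ ·)],
        φ.Satisfies G ↔ ∀ x : G, ∃! z : G, k • z = x := by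
  obtain ⟨ι, _, C, hC⟩ := exists_cones φ.lhs φ.rhs
  have hsol (x : Fin φ.n → ℤ) (z) : φ.IsSolution x z ↔ ConeRel C x z := hC _
  have hU := hA.isSolution_int_unique
  have hE := hA.exists_isSolution_nsmul
  have hU' : ∀ x z z', ConeRel C x z → ConeRel C x z' → z = z' := by simpa only [hsol] using hU
  obtain ⟨i, -⟩ := (hsol 0 0).1 EFDSystem.isSolution_zero
  have : Nonempty ι := ⟨i⟩
  obtain ⟨S, hS, hden⟩ := exists_denominators hU' (by simpa only [hsol] using hE)
  let k : ℕ := ∏ b ∈ S, b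
  have hk : 0 < k := Finset.prod_pos fun b hb => (hS b hb).1
  choose t ht using fun c => exists_term_eq_mul hU' (k := k) (c := c) fun x => by
    obtain ⟨b, hb, a, h⟩ := hden x c
    obtain ⟨d, hd⟩ := Finset.dvd_prod_of_mem (fun b => b) hb
    refine ⟨d * a, fun N hN z hz => ?_⟩
    have hkd : (k : ℤ) = b * d := by exact_mod_cast hd
    rw [hkd]
    linear_combination (d : ℤ) * h N hN z hz
  refine ⟨k, hk, fun G _ _ _ => ⟨fun hG y => ?_, fun hG x => ?_⟩⟩
  · refine existsUnique_of_exists_of_unique ?_ fun u v hu hv =>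
      eq_of_nsmul_eq_nsmul hk (hu.trans hv.symm)
    refine Finset.prod_induction (fun b => b) (fun b => ∀ y : G, ∃ u, b • u = y)
      (fun a b ha hb y => ?_) (fun y => ⟨y, one_smul _ y⟩) (fun b hb => ?_) y
    · obtain ⟨u, hu⟩ := ha y
      obtain ⟨v, hv⟩ := hb u
      exact ⟨v, by rw [mul_smul, hv, hu]⟩
    · obtain ⟨-, x, c, a, hab, h⟩ := hS b hb
      refine hG.exists_nsmul_eq (x := x) (c := c) hab (fun N z hz => ?_)
      rcases N.eq_zero_or_pos with rfl | hN
      · obtain rfl : z = 0 := hU 0 z 0 (by simpa using hz) EFDSystem.isSolution_zero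
        simp
      · exact h N hN z ((hsol _ _).1 hz)
  · choose z hz using fun c => (hG ((t c).realize x)).exists
    exact ⟨z, EFDSystem.isSolution_of_nsmul_eq hk t
      (fun x z h c => ht c x z ((hsol x z).1 h)) hE hz,
      fun z' hz' => EFDSystem.isSolution_unique hU hz' <| EFDSystem.isSolution_of_nsmul_eq hk t
        (fun x z h c => ht c x z ((hsol x z).1 h)) hE hz⟩
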